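/- Let f : ℝ → ℂ be bounded, integrable on ℝ, and continuous at 0. Then lim_{t → ∞} (1/t) ∫_ℝ f(α) · (sin(αt)/α)² dα = π · f(0). -/

import Mathlib

open MeasureTheory

/-- The Dirichlet kernel `sin ((2 * n + 1) * x) / sin x`, as a trigonometric polynomial. -/
noncomputable def dirichletKernel (n : ℕ) (x : ℝ) : ℝ :=
  1 + ∑ k ∈ Finset.range n, 2 * Real.cos (2 * ((k : ℝ) + 1) * x)

/-- The unnormalized Fejér kernel `(sin (n * x) / sin x) ^ 2`, as a trigonometric polynomial. -/
noncomputable def fejerKernel (n : ℕ) (x : ℝ) : ℝ :=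
  ∑ k ∈ Finset.range n, dirichletKernel k x

theorem sin_mul_dirichletKernel (n : ℕ) (x : ℝ) :
    Real.sin x * dirichletKernel n x = Real.sin ((2 * n + 1) * x) := by
  induction n with
  | zero => simp [dirichletKernel]
  | succ n ih =>
    have hstep : dirichletKernel (n + 1) x =
        dirichletKernel n x + 2 * Real.cos (2 * ((n : ℝ) + 1) * x) := by
      simp [dirichletKernel, Finset.sum_range_succ, add_assoc]
    have h₁ : (2 * ((n + 1 : ℕ) : ℝ) + 1) * x = 2 * ((n : ℝ) + 1) * x + x := by
      push_cast; ring
    have h₂ : (2 * (n : ℝ) + 1) * x = 2 * ((n : ℝ) + 1) * x - x := by ring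
    rw [hstep, mul_add, ih, h₁, h₂, Real.sin_add, Real.sin_sub]
    ring

theorem sin_sq_mul_fejerKernel (n : ℕ) (x : ℝ) :
    Real.sin x ^ 2 * fejerKernel n x = Real.sin (n * x) ^ 2 := by
  induction n with
  | zero => simp [fejerKernel]
  | succ n ih =>
    have hstep : fejerKernel (n + 1) x = fejerKernel n x + dirichletKernel n x := by
      simp [fejerKernel, Finset.sum_range_succ]
    have h₁ : ((n + 1 : ℕ) : ℝ) * x = n * x + x := by push_cast; ring
    have h₂ : (2 * (n : ℝ) + 1) * x = n * x + (n * x + x) := by ring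
    rw [hstep, mul_add, ih, sq (Real.sin x), mul_assoc, sin_mul_dirichletKernel, h₁, h₂,
      Real.sin_add (n * x) (n * x + x), Real.sin_add, Real.cos_add]
    linear_combination (-Real.sin (n * x) ^ 2) * Real.sin_sq_add_cos_sq x

theorem continuous_dirichletKernel (n : ℕ) : Continuous (dirichletKernel n) := by
  unfold dirichletKernel
  fun_prop

theorem continuous_fejerKernel (n : ℕ) : Continuous (fejerKernel n) :=
  continuous_finsetSum _ fun k _ => continuous_dirichletKernel k

theorem integral_dirichletKernel (n : ℕ) :
    ∫ x in -(Real.pi / 2)..Real.pi / 2, dirichletKernel n x = Real.pi := by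
  have hcos (k : ℕ) :
      ∫ x in -(Real.pi / 2)..Real.pi / 2, 2 * Real.cos (2 * ((k : ℝ) + 1) * x) = 0 := by
    have hk : (2 * ((k : ℝ) + 1)) ≠ 0 := by positivity
    have h₁ : 2 * ((k : ℝ) + 1) * (Real.pi / 2) = ((k + 1 : ℕ) : ℝ) * Real.pi := by
      push_cast; ring
    rw [intervalIntegral.integral_const_mul,
      intervalIntegral.integral_comp_mul_left (fun y => Real.cos y) hk, integral_cos, mul_neg,
      Real.sin_neg, h₁, Real.sin_nat_mul_pi]
    simp
  unfold dirichletKernel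
  rw [intervalIntegral.integral_add (by simp)
      ((by fun_prop : Continuous _).intervalIntegrable _ _),
    intervalIntegral.integral_finsetSum
      fun k _ => (by fun_prop : Continuous _).intervalIntegrable _ _]
  simp [hcos]

theorem integral_fejerKernel (n : ℕ) :
    ∫ x in -(Real.pi / 2)..Real.pi / 2, fejerKernel n x = n * Real.pi := by
  unfold fejerKernel
  rw [intervalIntegral.integral_finsetSum
    fun k _ => (continuous_dirichletKernel k).intervalIntegrable _ _]
  simp [integral_dirichletKernel]

theorem sin_div_self_sq_le (x : ℝ) : (Real.sin x / x) ^ 2 ≤ 2 * (1 + x ^ 2)⁻¹ := by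
  rcases eq_or_ne x 0 with rfl | hx
  · simp
  have h₁ : Real.sin x ^ 2 ≤ x ^ 2 := sq_le_sq.mpr Real.abs_sin_le_abs
  rw [div_pow, ← div_eq_mul_inv, div_le_div_iff₀ (by positivity) (by positivity)]
  nlinarith [mul_le_mul_of_nonneg_right (Real.sin_sq_le_one x) (sq_nonneg x)]

theorem integrable_sin_div_self_sq : Integrable fun x : ℝ => (Real.sin x / x) ^ 2 := by
  refine (integrable_inv_one_add_sq.const_mul 2).mono'
    (by fun_prop : Measurable _).aestronglyMeasurable (.of_forall fun x => ?_)
  rw [Real.norm_of_nonneg (sq_nonneg _)]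
  exact sin_div_self_sq_le x

theorem norm_fejerKernel_div_le {n : ℕ} (hn : n ≠ 0) {x : ℝ} (hx₀ : x ≠ 0)
    (hx : |x| ≤ n * (Real.pi / 2)) :
    ‖fejerKernel n (x / n) / n ^ 2‖ ≤ (Real.pi / 2) ^ 2 * (Real.sin x / x) ^ 2 := by
  have hn' : (0 : ℝ) < n := by positivity
  have hxn : |x / n| ≤ Real.pi / 2 := by
    rw [abs_div, Nat.abs_cast, div_le_iff₀ hn']
    linarith
  have hsin : 2 / Real.pi * |x / n| ≤ |Real.sin (x / n)| := Real.mul_abs_le_abs_sin hxn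
  have hpos : 0 < 2 / Real.pi * |x / n| := by positivity
  have hsq : (2 / Real.pi * |x / n|) ^ 2 ≤ Real.sin (x / n) ^ 2 := by
    rw [← sq_abs (Real.sin _)]
    gcongr
  have hker := sin_sq_mul_fejerKernel n (x / n)
  rw [mul_div_cancel₀ x hn'.ne'] at hker
  have hs : 0 < Real.sin (x / n) ^ 2 := (by positivity : (0 : ℝ) < _).trans_le hsq
  have hF : fejerKernel n (x / n) = Real.sin x ^ 2 / Real.sin (x / n) ^ 2 := by
    rw [eq_div_iff hs.ne', mul_comm, hker]
  rw [hF, Real.norm_of_nonneg (by positivity)]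
  calc Real.sin x ^ 2 / Real.sin (x / n) ^ 2 / n ^ 2
      ≤ Real.sin x ^ 2 / (2 / Real.pi * |x / n|) ^ 2 / n ^ 2 := by
        gcongr
    _ = (Real.pi / 2) ^ 2 * (Real.sin x / x) ^ 2 := by
        rw [mul_pow, sq_abs]
        field_simp

theorem tendsto_fejerKernel_div {x : ℝ} (hx : x ≠ 0) :
    Filter.Tendsto (fun n : ℕ => fejerKernel n (x / n) / n ^ 2) Filter.atTop
      (nhds ((Real.sin x / x) ^ 2)) := by
  have hdiv : Filter.Tendsto (fun n : ℕ => x / n) Filter.atTop (nhds 0) :=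
    tendsto_const_div_atTop_nhds_zero_nat x
  have hsinc : Filter.Tendsto (fun n : ℕ => Real.sinc (x / n)) Filter.atTop (nhds 1) := by
    rw [← Real.sinc_zero]
    exact (Real.continuous_sinc.tendsto 0).comp hdiv
  have hlim : Filter.Tendsto
      (fun n : ℕ => (Real.sin x / x) ^ 2 / Real.sinc (x / n) ^ 2) Filter.atTop
      (nhds ((Real.sin x / x) ^ 2)) := by
    have h := (tendsto_const_nhds (x := (Real.sin x / x) ^ 2)).div (hsinc.pow 2) (by simp)
    rwa [one_pow, div_one] at h
  refine hlim.congr' ?_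
  filter_upwards [hsinc.eventually_ne one_ne_zero, Filter.eventually_ne_atTop 0] with n hne hn
  have hn' : (n : ℝ) ≠ 0 := by exact_mod_cast hn
  have hker := sin_sq_mul_fejerKernel n (x / n)
  rw [mul_div_cancel₀ x hn'] at hker
  have hxn : x / n ≠ 0 := div_ne_zero hx hn'
  rw [Real.sinc_of_ne_zero hxn] at hne ⊢
  have hs : Real.sin (x / n) ≠ 0 := fun h => hne (by simp [h])
  rw [div_pow (Real.sin x), ← hker]
  field_simp

theorem integral_fejerKernel_div {n : ℕ} (hn : n ≠ 0) :
    ∫ x in Set.Ioc (-(n * (Real.pi / 2))) (n * (Real.pi / 2)), fejerKernel n (x / n) / n ^ 2 =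
      Real.pi := by
  have hn' : (n : ℝ) ≠ 0 := by exact_mod_cast hn
  have hle : -(n * (Real.pi / 2)) ≤ n * (Real.pi / 2) := by
    have : 0 ≤ n * (Real.pi / 2) := by positivity
    linarith
  rw [← intervalIntegral.integral_of_le hle, intervalIntegral.integral_div,
    intervalIntegral.integral_comp_div _ hn', neg_div, mul_div_cancel_left₀ _ hn',
    integral_fejerKernel, smul_eq_mul]
  field_simp

theorem integral_sin_div_self_sq : ∫ x : ℝ, (Real.sin x / x) ^ 2 = Real.pi := by
  let s (n : ℕ) : Set ℝ := Set.Ioc (-(n * (Real.pi / 2))) (n * (Real.pi / 2))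
  let F (n : ℕ) : ℝ → ℝ := (s n).indicator fun x => fejerKernel n (x / n) / n ^ 2
  have hmeas (n : ℕ) : AEStronglyMeasurable (F n) volume :=
    (((continuous_fejerKernel n).comp (by fun_prop)).div_const _).aestronglyMeasurable.indicator
      measurableSet_Ioc
  have hae : ∀ᵐ x : ℝ, x ≠ 0 := by simp [ae_iff]
  have hbound : ∀ᶠ n in Filter.atTop, ∀ᵐ x : ℝ,
      ‖F n x‖ ≤ (Real.pi / 2) ^ 2 * (Real.sin x / x) ^ 2 := by
    filter_upwards [Filter.eventually_ne_atTop 0] with n hn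
    filter_upwards [hae] with x hx
    by_cases hxs : x ∈ s n
    · have hx' : |x| ≤ n * (Real.pi / 2) := abs_le.mpr ⟨hxs.1.le, hxs.2⟩
      simp only [F, Set.indicator_of_mem hxs]
      exact norm_fejerKernel_div_le hn hx hx'
    · simp only [F, Set.indicator_of_notMem hxs, norm_zero]
      positivity
  have hlim : ∀ᵐ x : ℝ,
      Filter.Tendsto (fun n => F n x) Filter.atTop (nhds ((Real.sin x / x) ^ 2)) := by
    filter_upwards [hae] with x hx
    refine (tendsto_fejerKernel_div hx).congr' ?_
    have hgrow : Filter.Tendsto (fun n : ℕ => (n : ℝ) * (Real.pi / 2)) Filter.atTop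
        Filter.atTop := tendsto_natCast_atTop_atTop.atTop_mul_const (by positivity)
    filter_upwards [hgrow.eventually_gt_atTop |x|] with n hn
    have hxs : x ∈ s n := ⟨(abs_lt.mp hn).1, (abs_lt.mp hn).2.le⟩
    simp only [F, Set.indicator_of_mem hxs]
  have htend := tendsto_integral_filter_of_dominated_convergence _ (.of_forall hmeas) hbound
    (integrable_sin_div_self_sq.const_mul _) hlim
  refine tendsto_nhds_unique htend (tendsto_const_nhds.congr' ?_)
  filter_upwards [Filter.eventually_ne_atTop 0] with n hn
  simp only [F, s, integral_indicator measurableSet_Ioc, integral_fejerKernel_div hn]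



/-- The approximate-identity statement underlying the derivation of Fermi's golden rule:
for `f : ℝ → ℂ` bounded, integrable and continuous at `0`,
`lim_{t → ∞} (1/t) ∫ f(α) (sin(αt)/α)² dα = π f(0)`. -/
theorem golden_rule_kernel_limit (f : ℝ → ℂ)
    (hb : ∃ C : ℝ, ∀ x : ℝ, ‖f x‖ ≤ C)
    (hi : Integrable f) (hc : ContinuousAt f 0) :
    Filter.Tendsto
      (fun t : ℝ => (1 / (t : ℂ)) *
        ∫ α : ℝ, f α * (((Real.sin (α * t) / α : ℝ) : ℂ)) ^ 2)
      Filter.atTop (nhds ((Real.pi : ℂ) * f 0)) := by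
  obtain ⟨C, hC⟩ := hb
  have hscale : ∀ᶠ t : ℝ in Filter.atTop,
      ∫ x : ℝ, f (x * t⁻¹) * (((Real.sin x / x) ^ 2 : ℝ) : ℂ) = (1 / (t : ℂ)) *
        ∫ α : ℝ, f α * (((Real.sin (α * t) / α : ℝ) : ℂ)) ^ 2 := by
    filter_upwards [Filter.eventually_gt_atTop 0] with t ht
    have hsub := Measure.integral_comp_mul_right
      (fun α : ℝ => f α * (((Real.sin (α * t) / α : ℝ) : ℂ)) ^ 2) t⁻¹
    rw [inv_inv, abs_of_pos ht, Complex.real_smul] at hsub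
    have ht' : (t : ℂ) ≠ 0 := by exact_mod_cast ht.ne'
    rw [← mul_right_inj' (pow_ne_zero 2 ht'), ← integral_const_mul]
    calc ∫ x : ℝ, (t : ℂ) ^ 2 * (f (x * t⁻¹) * (((Real.sin x / x) ^ 2 : ℝ) : ℂ))
        = ∫ x : ℝ, f (x * t⁻¹) *
            (((Real.sin (x * t⁻¹ * t) / (x * t⁻¹) : ℝ) : ℂ)) ^ 2 := by
          congr 1 with x
          rw [inv_mul_cancel_right₀ ht.ne']
          push_cast
          field_simp
      _ = _ := by
          rw [hsub, ← mul_assoc]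
          congr 1
          field_simp
  refine Filter.Tendsto.congr' hscale ?_
  have hval : (Real.pi : ℂ) * f 0 = ∫ x : ℝ, f 0 * (((Real.sin x / x) ^ 2 : ℝ) : ℂ) := by
    rw [integral_const_mul, integral_complex_ofReal, integral_sin_div_self_sq, mul_comm]
  rw [hval]
  refine tendsto_integral_filter_of_dominated_convergence
    (fun x => C * (Real.sin x / x) ^ 2) ?_ ?_ (integrable_sin_div_self_sq.const_mul C) ?_
  · filter_upwards [Filter.eventually_gt_atTop 0] with t ht
    exact (hi.comp_mul_right' (inv_ne_zero ht.ne')).aestronglyMeasurable.mul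
      integrable_sin_div_self_sq.ofReal.aestronglyMeasurable
  · refine .of_forall fun t => .of_forall fun x => ?_
    rw [norm_mul, Complex.norm_real, Real.norm_of_nonneg (sq_nonneg _)]
    exact mul_le_mul_of_nonneg_right (hC _) (sq_nonneg _)
  · refine .of_forall fun x => Filter.Tendsto.mul_const _ (hc.tendsto.comp ?_)
    simpa using tendsto_inv_atTop_zero.const_mul x
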